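/- Let I ⊂ ℝ be a nonempty open interval and 0 < a < b. Let w : I × (a,b) × (ℝ³ \ {0}) → ℂ⁶ be smooth with w(t,r,λω) = w(t,r,ω) for all λ > 0, and assume that for every fixed ω ∈ S² each component of (t,x) ↦ w(t,|x|,ω) satisfies the wave equation ∂²ₜu − Δₓu = 0 on {(t,x) : t ∈ I, a < |x| < b}. Write u(t,x) := w(t,|x|, x/|x|) = (E(t,x), B(t,x)). If u satisfies the dynamic Maxwell equations ∂ₜE = curl B and ∂ₜB = −curl E on {(t,x) : t ∈ I, a < |x| < b}, then there exist a constant vector c ∈ ℂ⁶ and a function f : {x ∈ ℝ³ : a < |x| < b} → ℂ⁶ such that u(t,x) = f(x) + c·t for all such (t,x). -/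

import Mathlib

noncomputable section

open Real Set MeasureTheory

/-- Three dimensional Euclidean space. -/
abbrev R3 : Type := EuclideanSpace ℝ (Fin 3)

/-- The vector `(1,0,0)`. -/
def e1 : R3 := EuclideanSpace.single 0 1

/-- The cross product on `ℝ³`. -/
def cross3 (u v : R3) : R3 :=
  (WithLp.equiv 2 (Fin 3 → ℝ)).symm
    ![u 1 * v 2 - u 2 * v 1, u 2 * v 0 - u 0 * v 2, u 0 * v 1 - u 1 * v 0]

/-- Partial derivative in the `i`-th coordinate direction. -/
def pd {E : Type*} [NormedAddCommGroup E] [NormedSpace ℝ E]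
    (i : Fin 3) (f : R3 → E) (x : R3) : E :=
  fderiv ℝ f x (EuclideanSpace.single i 1)

/-- The curl of a vector field on `ℝ³`. -/
def curl3 (F : R3 → R3) (x : R3) : R3 :=
  (WithLp.equiv 2 (Fin 3 → ℝ)).symm
    ![pd 1 (fun y => F y 2) x - pd 2 (fun y => F y 1) x,
      pd 2 (fun y => F y 0) x - pd 0 (fun y => F y 2) x,
      pd 0 (fun y => F y 1) x - pd 1 (fun y => F y 0) x]

/-- The divergence of a vector field on `ℝ³`. -/
def div3 (F : R3 → R3) (x : R3) : ℝ :=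
  pd 0 (fun y => F y 0) x + pd 1 (fun y => F y 1) x + pd 2 (fun y => F y 2) x

/-- The wave operator `□u = ∂ₜ²u − Δₓu` applied to a function `u : ℝ × ℝ³ → ℂ`
(written in curried form), evaluated at `(t,x)`. -/
def waveOp (u : ℝ → R3 → ℂ) (t : ℝ) (x : R3) : ℂ :=
  deriv (fun s => deriv (fun s' => u s' x) s) t
    - (pd 0 (fun y => pd 0 (fun z => u t z) y) x
       + pd 1 (fun y => pd 1 (fun z => u t z) y) x
       + pd 2 (fun y => pd 2 (fun z => u t z) y) x)

/-- The curl of a `ℂ³`-valued spatial vector field. -/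
def curl3C (F : R3 → Fin 3 → ℂ) (x : R3) : Fin 3 → ℂ :=
  ![pd 1 (fun y => F y 2) x - pd 2 (fun y => F y 1) x,
    pd 2 (fun y => F y 0) x - pd 0 (fun y => F y 2) x,
    pd 0 (fun y => F y 1) x - pd 1 (fun y => F y 0) x]

section Auxiliary

open scoped ContDiff InnerProductSpace Topology

section DirectionalDerivative

variable {X Y E : Type*} [NormedAddCommGroup X] [NormedSpace ℝ X]
  [NormedAddCommGroup Y] [NormedSpace ℝ Y] [NormedAddCommGroup E] [NormedSpace ℝ E]

/-- The derivative of `f` in the direction `v`, as a function of the point. -/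
def dirDeriv (v : X) (f : X → E) (x : X) : E := fderiv ℝ f x v

lemma ContDiffOn.dirDeriv {f : X → E} {s : Set X} (hs : IsOpen s) (hf : ContDiffOn ℝ ∞ f s)
    (v : X) : ContDiffOn ℝ ∞ (dirDeriv v f) s :=
  (hf.fderiv_of_isOpen hs (m := ∞) (by simp)).clm_apply contDiffOn_const

lemma ContDiffOn.diffAt {f : X → E} {s : Set X} (hf : ContDiffOn ℝ ∞ f s) (hs : IsOpen s)
    {x : X} (hx : x ∈ s) : DifferentiableAt ℝ f x :=
  (hf.contDiffAt (hs.mem_nhds hx)).differentiableAt (by simp)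

lemma dirDeriv_congr {f g : X → E} {s : Set X} (hs : IsOpen s) (h : EqOn f g s) (v : X) :
    EqOn (dirDeriv v f) (dirDeriv v g) s := fun x hx => by
  simp only [dirDeriv, (h.eventuallyEq_of_mem (hs.mem_nhds hx)).fderiv_eq]

lemma dirDeriv_eq_zero_of_eqOn {f : X → E} {s : Set X} (hs : IsOpen s) (h : ∀ x ∈ s, f x = 0)
    (v : X) : ∀ x ∈ s, dirDeriv v f x = 0 := fun x hx => by
  rw [dirDeriv_congr hs (g := fun _ => 0) h v hx]; simp [dirDeriv]

lemma dirDeriv_comm {f : X → E} {s : Set X} (hs : IsOpen s) (hf : ContDiffOn ℝ ∞ f s) (u v : X) :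
    EqOn (dirDeriv u (dirDeriv v f)) (dirDeriv v (dirDeriv u f)) s := fun x hx => by
  have hc : ContDiffAt ℝ ∞ f x := hf.contDiffAt (hs.mem_nhds hx)
  have hd : DifferentiableAt ℝ (fderiv ℝ f) x :=
    (hf.fderiv_of_isOpen hs (m := ∞) (by simp)).diffAt hs hx
  have hsymm := hc.isSymmSndFDerivAt
    (by simp only [minSmoothness_of_isRCLikeNormedField]; norm_cast) u v
  have key (v : X) : fderiv ℝ (fun y => fderiv ℝ f y v) x
      = (fderiv ℝ (fderiv ℝ f) x).flip v := by
    rw [fderiv_clm_apply hd (by fun_prop)]; simp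
  change fderiv ℝ (fun y => fderiv ℝ f y v) x u = fderiv ℝ (fun y => fderiv ℝ f y u) x v
  rw [key, key]; exact hsymm

lemma dirDeriv_comp {f : X → E} {g : Y → X} {L : Y →L[ℝ] X} {y : Y} (hg : HasFDerivAt g L y)
    (hf : DifferentiableAt ℝ f (g y)) (v : Y) :
    dirDeriv v (fun y => f (g y)) y = dirDeriv (L v) f (g y) := by
  have := (hf.hasFDerivAt.comp y hg).fderiv
  simp only [dirDeriv]
  change fderiv ℝ (f ∘ g) y v = _
  rw [this]; rfl

lemma dirDeriv_sum_smul {ι : Type*} (t : Finset ι) (c : ι → ℝ) (v : ι → X) (f : X → E) (x : X) :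
    dirDeriv (∑ i ∈ t, c i • v i) f x = ∑ i ∈ t, c i • dirDeriv (v i) f x := by
  simp [dirDeriv]

end DirectionalDerivative

section Sphere

variable {E : Type*} [NormedAddCommGroup E] [NormedSpace ℝ E]

lemma sum_smul_single (x : R3) : ∑ i, x i • (EuclideanSpace.single i 1 : R3) = x := by
  ext j; fin_cases j <;> simp [Fin.sum_univ_three]

lemma norm_sq_eq_sum (x : R3) : ‖x‖ ^ 2 = ∑ i, x i ^ 2 := by
  simp [EuclideanSpace.norm_sq_eq]

lemma isOpen_punctured : IsOpen {x : R3 | x ≠ 0} := isOpen_ne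

/-- Euler's identity for functions which are homogeneous of degree zero. -/
lemma sum_smul_pd_eq_zero {h : R3 → E} {x : R3} (hd : DifferentiableAt ℝ h x)
    (hhom : ∀ l : ℝ, 0 < l → h (l • x) = h x) : ∑ i, x i • pd i h x = 0 := by
  have h1 : HasDerivAt (fun l : ℝ => h (l • x)) (fderiv ℝ h x x) 1 := by
    have hL : HasDerivAt (fun l : ℝ => l • x) x 1 := by
      simpa using (hasDerivAt_id (1 : ℝ)).smul_const x
    have hd' : HasFDerivAt h (fderiv ℝ h x) ((1 : ℝ) • x) := by simpa using hd.hasFDerivAt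
    exact hd'.comp_hasDerivAt (1 : ℝ) hL
  have h2 : HasDerivAt (fun l : ℝ => h (l • x)) 0 1 := by
    refine (hasDerivAt_const (1 : ℝ) (h x)).congr_of_eventuallyEq ?_
    filter_upwards [lt_mem_nhds one_pos] with l hl using hhom l hl
  have h3 := h1.unique h2
  have h4 := dirDeriv_sum_smul Finset.univ (fun i => x i)
    (fun i => (EuclideanSpace.single i 1 : R3)) h x
  rw [sum_smul_single] at h4
  exact h4.symm.trans h3

lemma integral_pd_eq_zero {f : R3 → ℝ} (hf : ContDiff ℝ 1 f) (hc : HasCompactSupport f)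
    (i : Fin 3) : Integrable (pd i f) ∧ ∫ x, pd i f x = 0 := by
  have hcont : Continuous (pd i f) := by
    have := hf.continuous_fderiv (by simp)
    unfold pd; fun_prop
  have hint : Integrable (pd i f) := hcont.integrable_of_hasCompactSupport
    (hc.fderiv_apply (𝕜 := ℝ) _)
  refine ⟨hint, ?_⟩
  have := integral_mul_fderiv_eq_neg_fderiv_mul_of_integrable (μ := (volume : Measure R3))
    (f := f) (g := fun _ => (1 : ℝ)) (v := EuclideanSpace.single i 1)
    (by simpa only [mul_one] using! hint) (by simp)
    (by simpa using hf.continuous.integrable_of_hasCompactSupport hc)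
    (fun x _ => hf.differentiable (by simp) x) (fun x _ => by fun_prop)
  simpa [pd] using this.symm

/-- A degree zero homogeneous harmonic function on `ℝ³ ∖ {0}` has vanishing gradient. -/
lemma pd_eq_zero_of_harmonic_of_homogeneous {H : Type*} [NormedAddCommGroup H]
    [InnerProductSpace ℝ H] {h : R3 → H} (hs : ContDiffOn ℝ ∞ h {x | x ≠ 0})
    (hhom : ∀ x : R3, x ≠ 0 → ∀ l : ℝ, 0 < l → h (l • x) = h x)
    (hharm : ∀ x : R3, x ≠ 0 → ∑ i, pd i (pd i h) x = 0) :
    ∀ x : R3, ‖x‖ = 1 → ∀ i, pd i h x = 0 := by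
  let ψ : ContDiffBump (1 : ℝ) := ⟨1 / 4, 1 / 2, by norm_num, by norm_num⟩
  let Φ : R3 → ℝ := fun x => ψ (‖x‖ ^ 2)
  have hΦs : ContDiff ℝ ∞ Φ := ψ.contDiff.comp (contDiff_norm_sq ℝ)
  have hΦ0 : ∀ x : R3, ‖x‖ ^ 2 < 1 / 2 → Φ x = 0 := fun x hx => by
    apply ψ.zero_of_le_dist
    rw [Real.dist_eq, abs_of_neg (by linarith)]
    change (1 / 2 : ℝ) ≤ _
    linarith
  have hΦc : HasCompactSupport Φ := by
    refine HasCompactSupport.intro (isCompact_closedBall (0 : R3) 2) fun x hx => ?_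
    apply ψ.zero_of_le_dist
    have : 2 < ‖x‖ := by simpa using hx
    rw [Real.dist_eq, abs_of_pos (by nlinarith)]
    change (1 / 2 : ℝ) ≤ _
    nlinarith
  have hpds (i : Fin 3) : ContDiffOn ℝ ∞ (pd i h) {x | x ≠ 0} := hs.dirDeriv isOpen_punctured _
  have hnear : ∀ᶠ y : R3 in 𝓝 0, Φ y = 0 := by
    have : Metric.ball (0 : R3) (1 / 2) ∈ 𝓝 0 := Metric.ball_mem_nhds _ (by norm_num)
    filter_upwards [this] with y hy
    have : ‖y‖ < 1 / 2 := by simpa using hy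
    exact hΦ0 y (by nlinarith [norm_nonneg y])
  let K : Fin 3 → R3 → ℝ := fun i x => Φ x * ⟪h x, pd i h x⟫_ℝ
  have hKs (i : Fin 3) : ContDiff ℝ 1 (K i) := by
    rw [contDiff_iff_contDiffAt]
    intro x
    by_cases hx : x = 0
    · subst hx
      refine (contDiffAt_const (c := (0 : ℝ))).congr_of_eventuallyEq ?_
      filter_upwards [hnear] with y hy
      simp [K, hy]
    · have hm := isOpen_punctured.mem_nhds hx
      exact ((hΦs.contDiffAt.mul ((hs.contDiffAt hm).inner ℝ ((hpds i).contDiffAt hm))).of_le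
        (by norm_cast))
  have hKc (i : Fin 3) : HasCompactSupport (K i) := hΦc.mul_right
  have hdiv : ∀ x, ∑ i, pd i (K i) x = Φ x * ∑ i, ‖pd i h x‖ ^ 2 := by
    intro x
    by_cases hx : x = 0
    · subst hx
      have (i : Fin 3) : pd i (K i) 0 = 0 := by
        have : K i =ᶠ[𝓝 0] fun _ => 0 := by
          filter_upwards [hnear] with y hy
          simp [K, hy]
        simp [pd, this.fderiv_eq]
      simp [this, hnear.self_of_nhds]
    · have hd := hs.diffAt isOpen_punctured hx
      have hdi (i) := (hpds i).diffAt isOpen_punctured hx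
      have hΦd : DifferentiableAt ℝ Φ x := hΦs.differentiable (by simp) x
      have hΦ' (i : Fin 3) : pd i Φ x = 2 * deriv ψ (‖x‖ ^ 2) * x i := by
        have h1 : HasDerivAt ψ (deriv ψ (‖x‖ ^ 2)) (‖x‖ ^ 2) :=
          (ψ.contDiff (n := 1)).differentiable (by simp) _ |>.hasDerivAt
        have h2 := (h1.comp_hasFDerivAt x (hasStrictFDerivAt_norm_sq x).hasFDerivAt).fderiv
        change fderiv ℝ (ψ ∘ fun y : R3 => ‖y‖ ^ 2) x _ = _
        rw [h2]
        simp [EuclideanSpace.inner_single_right]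
        ring
      have hK (i : Fin 3) : pd i (K i) x = Φ x * ‖pd i h x‖ ^ 2 + Φ x * ⟪h x, pd i (pd i h) x⟫_ℝ
          + 2 * deriv ψ (‖x‖ ^ 2) * ⟪h x, x i • pd i h x⟫_ℝ := by
        have : pd i (K i) x = Φ x * (pd i (fun y => ⟪h y, pd i h y⟫_ℝ) x)
            + pd i Φ x * ⟪h x, pd i h x⟫_ℝ := by
          change fderiv ℝ (fun y => Φ y * ⟪h y, pd i h y⟫_ℝ) x _ = _
          rw [fderiv_fun_mul hΦd (hd.inner ℝ (hdi i))]
          simp only [pd, _root_.add_apply, _root_.smul_apply, smul_eq_mul]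
          ring
        rw [this, hΦ', ← real_inner_self_eq_norm_sq (pd i h x), inner_smul_right]
        have : pd i (fun y => ⟪h y, pd i h y⟫_ℝ) x
            = ⟪h x, pd i (pd i h) x⟫_ℝ + ⟪pd i h x, pd i h x⟫_ℝ :=
          fderiv_inner_apply ℝ hd (hdi i) _
        rw [this]
        ring
      simp only [hK, Finset.sum_add_distrib, ← Finset.mul_sum, ← inner_sum, hharm x hx,
        sum_smul_pd_eq_zero hd (hhom x hx)]
      simp
  have hint : ∫ x, Φ x * ∑ i, ‖pd i h x‖ ^ 2 = 0 := by
    simp only [← hdiv]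
    rw [integral_finsetSum _ fun i _ => (integral_pd_eq_zero (hKs i) (hKc i) i).1]
    exact Finset.sum_eq_zero fun i _ => (integral_pd_eq_zero (hKs i) (hKc i) i).2
  have hcont : Continuous fun x => Φ x * ∑ i, ‖pd i h x‖ ^ 2 := by
    simp only [← hdiv]
    refine continuous_finsetSum _ fun i _ => ?_
    have := (hKs i).continuous_fderiv (by simp)
    unfold pd; fun_prop
  intro x hx i
  by_contra hne
  have hpos : 0 < ∫ x, Φ x * ∑ i, ‖pd i h x‖ ^ 2 := by
    refine hcont.integral_pos_of_hasCompactSupport_nonneg_nonzero hΦc.mul_right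
      (fun x => mul_nonneg ψ.nonneg (Finset.sum_nonneg fun i _ => by positivity)) (x := x) ?_
    have h1 : Φ x = 1 := by
      simp only [Φ, hx, one_pow]
      exact ψ.one_of_mem_closedBall (Metric.mem_closedBall_self ψ.rIn_pos.le)
    rw [h1, one_mul]
    have : 0 < ‖pd i h x‖ ^ 2 := by positivity
    exact (this.trans_le (Finset.single_le_sum (f := fun i => ‖pd i h x‖ ^ 2)
      (fun i _ => by positivity) (Finset.mem_univ i))).ne'
  exact hpos.ne' hint

end Sphere

section Polar

variable {E : Type*} [NormedAddCommGroup E] [NormedSpace ℝ E] {I : Set ℝ} {a b : ℝ}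

/-- The domain `I × (a,b) × (ℝ³ ∖ {0})` of a modulated spherical profile. -/
def profileDomain (I : Set ℝ) (a b : ℝ) : Set (ℝ × ℝ × R3) :=
  I ×ˢ Ioo a b ×ˢ {x : R3 | x ≠ 0}

/-- The space-time shell `{(t,x) : t ∈ I, a < |x| < b}`. -/
def shell (I : Set ℝ) (a b : ℝ) : Set (ℝ × R3) :=
  I ×ˢ {x : R3 | ‖x‖ ∈ Ioo a b}

/-- The map `(t,x) ↦ (t,|x|,x)`. -/
def polar (q : ℝ × R3) : ℝ × ℝ × R3 := (q.1, ‖q.2‖, q.2)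

/-- The time direction in profile coordinates. -/
def profT : ℝ × ℝ × R3 := (1, 0, 0)

/-- The radial direction in profile coordinates. -/
def profR : ℝ × ℝ × R3 := (0, 1, 0)

/-- The `i`-th spatial direction in profile coordinates. -/
def profX (i : Fin 3) : ℝ × ℝ × R3 := (0, 0, EuclideanSpace.single i 1)

/-- The time direction in space-time. -/
def dirT : ℝ × R3 := (1, 0)

/-- The `i`-th spatial direction in space-time. -/
def dirX (i : Fin 3) : ℝ × R3 := (0, EuclideanSpace.single i 1)

lemma isOpen_profileDomain (hI : IsOpen I) : IsOpen (profileDomain I a b) :=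
  hI.prod (isOpen_Ioo.prod isOpen_punctured)

lemma isOpen_shell (hI : IsOpen I) : IsOpen (shell I a b) :=
  hI.prod (isOpen_Ioo.preimage continuous_norm)

lemma ne_zero_of_mem_shell (ha : 0 < a) {q : ℝ × R3} (hq : q ∈ shell I a b) : q.2 ≠ 0 :=
  norm_pos_iff.1 (ha.trans hq.2.1)

lemma polar_mem (ha : 0 < a) {q : ℝ × R3} (hq : q ∈ shell I a b) :
    polar q ∈ profileDomain I a b :=
  have hx := ne_zero_of_mem_shell ha hq
  ⟨hq.1, hq.2, hx⟩

lemma contDiffOn_comp_polar (ha : 0 < a) {F : ℝ × ℝ × R3 → E}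
    (hF : ContDiffOn ℝ ∞ F (profileDomain I a b)) :
    ContDiffOn ℝ ∞ (fun q => F (polar q)) (shell I a b) := by
  have hpolar : ContDiffOn ℝ ∞ polar (shell I a b) := fun q hq =>
    ContDiffAt.contDiffWithinAt ?_
  · exact hF.comp hpolar fun q hq => polar_mem ha hq
  have h2 : ContDiffAt ℝ ∞ (fun q : ℝ × R3 => q.2) q := contDiffAt_snd
  exact contDiffAt_fst.prodMk ((h2.norm ℝ (ne_zero_of_mem_shell ha hq)).prodMk h2)

lemma hasFDerivAt_norm_of_ne_zero {x : R3} (hx : x ≠ 0) :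
    HasFDerivAt (fun y : R3 => ‖y‖) (‖x‖⁻¹ • innerSL ℝ x) x := by
  have h := (hasStrictFDerivAt_norm_sq x).hasFDerivAt.sqrt (by positivity)
  simp only [Real.sqrt_sq (norm_nonneg _)] at h
  convert! h using 1
  ext v
  simp
  field_simp

/-- The derivative of `polar`. -/
def polarDeriv (q : ℝ × R3) : ℝ × R3 →L[ℝ] ℝ × ℝ × R3 :=
  (ContinuousLinearMap.fst ℝ ℝ R3).prod
    (((‖q.2‖⁻¹ • innerSL ℝ q.2).comp (ContinuousLinearMap.snd ℝ ℝ R3)).prod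
      (ContinuousLinearMap.snd ℝ ℝ R3))

lemma hasFDerivAt_polar {q : ℝ × R3} (hq : q.2 ≠ 0) : HasFDerivAt polar (polarDeriv q) q :=
  hasFDerivAt_fst.prodMk
    (((hasFDerivAt_norm_of_ne_zero hq).comp q hasFDerivAt_snd).prodMk hasFDerivAt_snd)

lemma polarDeriv_dirT (q : ℝ × R3) : polarDeriv q dirT = profT := by
  simp [polarDeriv, dirT, profT]

lemma polarDeriv_dirX (q : ℝ × R3) (i : Fin 3) :
    polarDeriv q (dirX i) = (‖q.2‖⁻¹ * q.2 i) • profR + profX i := by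
  simp [polarDeriv, dirX, profR, profX, EuclideanSpace.inner_single_right]

lemma dirDeriv_dirT_polar (hI : IsOpen I) (ha : 0 < a) {F : ℝ × ℝ × R3 → E}
    (hF : ContDiffOn ℝ ∞ F (profileDomain I a b)) :
    EqOn (dirDeriv dirT fun q => F (polar q)) (fun q => dirDeriv profT F (polar q))
      (shell I a b) := fun q hq => by
  rw [dirDeriv_comp (hasFDerivAt_polar (ne_zero_of_mem_shell ha hq))
    (hF.diffAt (isOpen_profileDomain hI) (polar_mem ha hq)), polarDeriv_dirT]

lemma dirDeriv_dirX_polar (hI : IsOpen I) (ha : 0 < a) {F : ℝ × ℝ × R3 → E}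
    (hF : ContDiffOn ℝ ∞ F (profileDomain I a b)) (i : Fin 3) :
    EqOn (dirDeriv (dirX i) fun q => F (polar q))
      (fun q => (‖q.2‖⁻¹ * q.2 i) • dirDeriv profR F (polar q) + dirDeriv (profX i) F (polar q))
      (shell I a b) := fun q hq => by
  rw [dirDeriv_comp (hasFDerivAt_polar (ne_zero_of_mem_shell ha hq))
    (hF.diffAt (isOpen_profileDomain hI) (polar_mem ha hq)), polarDeriv_dirX]
  simp [dirDeriv]

/-- The function `(t,r,x) ↦ xᵢ / r`. -/
def radialSlope (i : Fin 3) (p : ℝ × ℝ × R3) : ℝ := p.2.1⁻¹ * p.2.2 i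

lemma contDiffAt_radialSlope (i : Fin 3) {p : ℝ × ℝ × R3} (hp : p.2.1 ≠ 0) :
    ContDiffAt ℝ ∞ (radialSlope i) p := by
  unfold radialSlope
  have h1 : ContDiffAt ℝ ∞ (fun p : ℝ × ℝ × R3 => p.2.1) p := by fun_prop
  have h2 : ContDiffAt ℝ ∞ (fun p : ℝ × ℝ × R3 => p.2.2 i) p := by fun_prop
  exact (h1.inv hp).mul h2

lemma fderiv_radialSlope (i : Fin 3) {p : ℝ × ℝ × R3} (hp : p.2.1 ≠ 0) (v : ℝ × ℝ × R3) :
    fderiv ℝ (radialSlope i) p v = p.2.1⁻¹ * v.2.2 i - p.2.2 i / p.2.1 ^ 2 * v.2.1 := by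
  have h1 : HasFDerivAt (fun p : ℝ × ℝ × R3 => p.2.1)
      ((ContinuousLinearMap.fst ℝ ℝ R3).comp (ContinuousLinearMap.snd ℝ ℝ (ℝ × R3))) p :=
    hasFDerivAt_fst.comp p hasFDerivAt_snd
  have h2 : HasFDerivAt (fun p : ℝ × ℝ × R3 => p.2.2 i)
      ((EuclideanSpace.proj i : R3 →L[ℝ] ℝ).comp
        ((ContinuousLinearMap.snd ℝ ℝ R3).comp (ContinuousLinearMap.snd ℝ ℝ (ℝ × R3)))) p :=
    ((EuclideanSpace.proj i : R3 →L[ℝ] ℝ).comp ((ContinuousLinearMap.snd ℝ ℝ R3).comp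
      (ContinuousLinearMap.snd ℝ ℝ (ℝ × R3)))).hasFDerivAt
  have h3 := (((hasDerivAt_inv hp).comp_hasFDerivAt p h1).mul h2).fderiv
  change fderiv ℝ (((fun y : ℝ => y⁻¹) ∘ fun p : ℝ × ℝ × R3 => p.2.1) *
    fun p : ℝ × ℝ × R3 => p.2.2 i) p v = _
  rw [show ((fun y : ℝ => y⁻¹) ∘ fun p : ℝ × ℝ × R3 => p.2.1) * (fun p : ℝ × ℝ × R3 => p.2.2 i)
    = ((Inv.inv : ℝ → ℝ) ∘ fun p : ℝ × ℝ × R3 => p.2.1) * (fun p : ℝ × ℝ × R3 => p.2.2 i)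
    from rfl, h3]
  simp
  ring

lemma ne_zero_of_mem_profileDomain (ha : 0 < a) {p : ℝ × ℝ × R3} (hp : p ∈ profileDomain I a b) :
    p.2.1 ≠ 0 := (ha.trans hp.2.1.1).ne'

lemma dirDeriv_add_smul {X : Type*} [NormedAddCommGroup X] [NormedSpace ℝ X] {c : X → ℝ}
    {f g : X → E} {x : X} (hc : DifferentiableAt ℝ c x) (hf : DifferentiableAt ℝ f x)
    (hg : DifferentiableAt ℝ g x) (v : X) :
    dirDeriv v (fun y => c y • f y + g y) x
      = c x • dirDeriv v f x + fderiv ℝ c x v • f x + dirDeriv v g x := by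
  unfold dirDeriv
  rw [fderiv_fun_add (hc.fun_smul hf) hg, fderiv_fun_smul hc hf]
  simp

lemma dirDeriv_dirX_dirX_polar (hI : IsOpen I) (ha : 0 < a) {F : ℝ × ℝ × R3 → E}
    (hF : ContDiffOn ℝ ∞ F (profileDomain I a b)) (i : Fin 3) {q : ℝ × R3}
    (hq : q ∈ shell I a b) :
    dirDeriv (dirX i) (dirDeriv (dirX i) fun q => F (polar q)) q
      = (q.2 i ^ 2 / ‖q.2‖ ^ 2) • dirDeriv profR (dirDeriv profR F) (polar q)
        + (1 / ‖q.2‖ - q.2 i ^ 2 / ‖q.2‖ ^ 3) • dirDeriv profR F (polar q)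
        + (2 / ‖q.2‖) • (q.2 i • dirDeriv (profX i) (dirDeriv profR F) (polar q))
        + dirDeriv (profX i) (dirDeriv (profX i) F) (polar q) := by
  have hO := isOpen_profileDomain (a := a) (b := b) hI
  have hR := hF.dirDeriv hO profR
  have hX := hF.dirDeriv hO (profX i)
  have hsl : ContDiffOn ℝ ∞ (radialSlope i) (profileDomain I a b) := fun p hp =>
    (contDiffAt_radialSlope i (ne_zero_of_mem_profileDomain ha hp)).contDiffWithinAt
  have hp := polar_mem ha hq
  have hr : ‖q.2‖ ≠ 0 := ne_zero_of_mem_profileDomain ha hp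
  rw [dirDeriv_congr (isOpen_shell hI) (dirDeriv_dirX_polar hI ha hF i) _ hq]
  refine (dirDeriv_dirX_polar hI ha
    (F := fun p => radialSlope i p • dirDeriv profR F p + dirDeriv (profX i) F p)
    ((hsl.smul hR).add hX) i hq).trans ?_
  simp only [dirDeriv_add_smul (hsl.diffAt hO hp) (hR.diffAt hO hp) (hX.diffAt hO hp),
    fderiv_radialSlope i (p := polar q) hr]
  rw [dirDeriv_comm hO hF profR (profX i) hp]
  simp only [radialSlope, profR, profX, polar, PiLp.zero_apply, PiLp.single_apply, if_true]
  match_scalars <;> field_simp <;> ring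

lemma laplacian_polar (hI : IsOpen I) (ha : 0 < a) {F : ℝ × ℝ × R3 → E}
    (hF : ContDiffOn ℝ ∞ F (profileDomain I a b)) {q : ℝ × R3} (hq : q ∈ shell I a b) :
    ∑ i, dirDeriv (dirX i) (dirDeriv (dirX i) fun q => F (polar q)) q
      = dirDeriv profR (dirDeriv profR F) (polar q)
        + (2 / ‖q.2‖) • dirDeriv profR F (polar q)
        + (2 / ‖q.2‖) • ∑ i, q.2 i • dirDeriv (profX i) (dirDeriv profR F) (polar q)
        + ∑ i, dirDeriv (profX i) (dirDeriv (profX i) F) (polar q) := by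
  have hr : ‖q.2‖ ≠ 0 := norm_ne_zero_iff.2 (ne_zero_of_mem_shell ha hq)
  simp only [dirDeriv_dirX_dirX_polar hI ha hF _ hq, Finset.sum_add_distrib, ← Finset.sum_smul,
    ← Finset.smul_sum]
  have h1 : ∑ i, q.2 i ^ 2 / ‖q.2‖ ^ 2 = 1 := by
    rw [← Finset.sum_div, ← norm_sq_eq_sum]; field_simp
  have h2 : ∑ i, (1 / ‖q.2‖ - q.2 i ^ 2 / ‖q.2‖ ^ 3) = 2 / ‖q.2‖ := by
    rw [Finset.sum_sub_distrib, ← Finset.sum_div Finset.univ (fun i => q.2 i ^ 2), ← norm_sq_eq_sum]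
    simp
    field_simp
    norm_num
  rw [h1, h2, one_smul]

/-- `F (t,r,x)` is homogeneous of degree `-k` in `x`. -/
def HomNeg (I : Set ℝ) (a b : ℝ) (k : ℕ) (F : ℝ × ℝ × R3 → E) : Prop :=
  ∀ p ∈ profileDomain I a b, ∀ l : ℝ, 0 < l → F p = l ^ k • F (p.1, p.2.1, l • p.2.2)

/-- The linear map `(t,r,x) ↦ (t,r,lx)`. -/
def dilate (l : ℝ) : ℝ × ℝ × R3 →L[ℝ] ℝ × ℝ × R3 :=
  (ContinuousLinearMap.id ℝ ℝ).prodMap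
    ((ContinuousLinearMap.id ℝ ℝ).prodMap (l • ContinuousLinearMap.id ℝ R3))

lemma dilate_apply (l : ℝ) (p : ℝ × ℝ × R3) : dilate l p = (p.1, p.2.1, l • p.2.2) := rfl

lemma dilate_mem {p : ℝ × ℝ × R3} (hp : p ∈ profileDomain I a b) {l : ℝ} (hl : 0 < l) :
    (p.1, p.2.1, l • p.2.2) ∈ profileDomain I a b :=
  ⟨hp.1, hp.2.1, smul_ne_zero hl.ne' hp.2.2⟩

lemma HomNeg.dirDeriv_dilate (hI : IsOpen I) {k : ℕ} {F : ℝ × ℝ × R3 → E}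
    (hF : ContDiffOn ℝ ∞ F (profileDomain I a b)) (h : HomNeg I a b k F) (v : ℝ × ℝ × R3)
    {p : ℝ × ℝ × R3} (hp : p ∈ profileDomain I a b) {l : ℝ} (hl : 0 < l) :
    dirDeriv v F p = l ^ k • dirDeriv (dilate l v) F (p.1, p.2.1, l • p.2.2) := by
  have hO := isOpen_profileDomain (a := a) (b := b) hI
  have hd : DifferentiableAt ℝ F (dilate l p) := hF.diffAt hO (dilate_mem hp hl)
  have h1 : EqOn F (fun p => l ^ k • F (dilate l p)) (profileDomain I a b) :=
    fun p hp => h p hp l hl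
  rw [dirDeriv_congr hO h1 v hp, ← dilate_apply, ← dirDeriv_comp (dilate l).hasFDerivAt hd]
  unfold dirDeriv
  have hd' : DifferentiableAt ℝ (fun y => F (dilate l y)) p :=
    hd.comp p (dilate l).differentiableAt
  rw [fderiv_fun_const_smul hd']
  rfl

lemma HomNeg.dirDeriv_profT (hI : IsOpen I) {k : ℕ} {F : ℝ × ℝ × R3 → E}
    (hF : ContDiffOn ℝ ∞ F (profileDomain I a b)) (h : HomNeg I a b k F) :
    HomNeg I a b k (dirDeriv profT F) := fun p hp l hl => by
  rw [h.dirDeriv_dilate hI hF _ hp hl]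
  simp [dilate_apply, profT]

lemma HomNeg.dirDeriv_profR (hI : IsOpen I) {k : ℕ} {F : ℝ × ℝ × R3 → E}
    (hF : ContDiffOn ℝ ∞ F (profileDomain I a b)) (h : HomNeg I a b k F) :
    HomNeg I a b k (dirDeriv profR F) := fun p hp l hl => by
  rw [h.dirDeriv_dilate hI hF _ hp hl]
  simp [dilate_apply, profR]

lemma HomNeg.dirDeriv_profX (hI : IsOpen I) {k : ℕ} {F : ℝ × ℝ × R3 → E}
    (hF : ContDiffOn ℝ ∞ F (profileDomain I a b)) (h : HomNeg I a b k F) (i : Fin 3) :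
    HomNeg I a b (k + 1) (dirDeriv (profX i) F) := fun p hp l hl => by
  rw [h.dirDeriv_dilate hI hF _ hp hl]
  have : dilate l (profX i) = l • profX i := by
    simp [dilate_apply, profX]
  rw [this, pow_succ, mul_smul]
  simp [dirDeriv]

/-- A homogeneous function vanishing where `r = |x|` vanishes identically. -/
lemma HomNeg.eq_zero_of_polar (ha : 0 < a) {k : ℕ} {F : ℝ × ℝ × R3 → E} (h : HomNeg I a b k F)
    (h0 : ∀ q ∈ shell I a b, F (polar q) = 0) : ∀ p ∈ profileDomain I a b, F p = 0 := by
  intro p hp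
  have hx : 0 < ‖p.2.2‖ := norm_pos_iff.2 hp.2.2
  have hr : 0 < p.2.1 := ha.trans hp.2.1.1
  have hl : 0 < p.2.1 / ‖p.2.2‖ := by positivity
  have hn : ‖(p.2.1 / ‖p.2.2‖) • p.2.2‖ = p.2.1 := by
    rw [norm_smul, Real.norm_of_nonneg hl.le]; field_simp
  have h1 := h0 (p.1, (p.2.1 / ‖p.2.2‖) • p.2.2) ⟨hp.1, by
    rw [mem_ofPred_eq, hn]; exact hp.2.1⟩
  rw [h p hp _ hl]
  simp only [polar, hn] at h1
  rw [h1, smul_zero]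

lemma pd_slice {F : ℝ × ℝ × R3 → E} {t r : ℝ} {x : R3} (hF : DifferentiableAt ℝ F (t, r, x))
    (i : Fin 3) : pd i (fun y => F (t, r, y)) x = dirDeriv (profX i) F (t, r, x) := by
  have hg : HasFDerivAt (fun y : R3 => (t, r, y)) ((ContinuousLinearMap.inr ℝ ℝ (ℝ × R3)).comp
      (ContinuousLinearMap.inr ℝ ℝ R3)) x :=
    (hasFDerivAt_prodMk_right t (r, x)).comp x (hasFDerivAt_prodMk_right r x)
  exact dirDeriv_comp hg hF _

lemma contDiffOn_slice {F : ℝ × ℝ × R3 → E} (hF : ContDiffOn ℝ ∞ F (profileDomain I a b))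
    {t r : ℝ} (ht : t ∈ I) (hr : r ∈ Ioo a b) :
    ContDiffOn ℝ ∞ (fun y => F (t, r, y)) {x | x ≠ 0} :=
  hF.comp (f := fun y : R3 => (t, r, y)) (by fun_prop) fun _ hx => ⟨ht, hr, hx⟩

lemma HomNeg.sum_smul_profX (hI : IsOpen I) {F : ℝ × ℝ × R3 → E}
    (hF : ContDiffOn ℝ ∞ F (profileDomain I a b)) (h : HomNeg I a b 0 F)
    {p : ℝ × ℝ × R3} (hp : p ∈ profileDomain I a b) :
    ∑ i, p.2.2 i • dirDeriv (profX i) F p = 0 := by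
  have h1 := sum_smul_pd_eq_zero (h := fun y => F (p.1, p.2.1, y)) (x := p.2.2)
    ((contDiffOn_slice hF hp.1 hp.2.1).diffAt isOpen_punctured hp.2.2)
    (fun l hl => by simpa using (h p hp l hl).symm)
  simpa only [pd_slice (hF.diffAt (isOpen_profileDomain hI) hp)] using h1

/-- If `F` satisfies the radial wave equation for each fixed `x` and `F (t,|x|,x)` satisfies the
wave equation, then the degree zero homogeneous `F` does not depend on `x`. -/
lemma HomNeg.dirDeriv_profX_eq_zero {H : Type*} [NormedAddCommGroup H] [InnerProductSpace ℝ H]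
    (hI : IsOpen I) (ha : 0 < a) {F : ℝ × ℝ × R3 → H}
    (hF : ContDiffOn ℝ ∞ F (profileDomain I a b)) (h : HomNeg I a b 0 F)
    (hrad : ∀ p ∈ profileDomain I a b, dirDeriv profT (dirDeriv profT F) p
      = dirDeriv profR (dirDeriv profR F) p
        + (2 / p.2.1) • dirDeriv profR F p)
    (hwave : ∀ q ∈ shell I a b, dirDeriv dirT (dirDeriv dirT fun q => F (polar q)) q
      = ∑ i, dirDeriv (dirX i) (dirDeriv (dirX i) fun q => F (polar q)) q) (i : Fin 3) :
    ∀ p ∈ profileDomain I a b, dirDeriv (profX i) F p = 0 := by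
  have hO := isOpen_profileDomain (a := a) (b := b) hI
  have hlap : ∀ p ∈ profileDomain I a b,
      ∑ i, dirDeriv (profX i) (dirDeriv (profX i) F) p = 0 := by
    refine HomNeg.eq_zero_of_polar (k := 2)
      (F := fun p => ∑ i, dirDeriv (profX i) (dirDeriv (profX i) F) p) ha ?_ ?_
    · intro p hp l hl
      rw [Finset.smul_sum]
      exact Finset.sum_congr rfl fun i _ =>
        ((h.dirDeriv_profX hI hF i).dirDeriv_profX hI (hF.dirDeriv hO _) i) p hp l hl
    · intro q hq
      have hp := polar_mem ha hq
      have h1 := hwave q hq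
      have h2 := (h.dirDeriv_profR hI hF).sum_smul_profX hI (hF.dirDeriv hO _) hp
      have h3 := hrad _ hp
      simp only [polar] at h2 h3
      rw [laplacian_polar hI ha hF hq,
        dirDeriv_congr (isOpen_shell hI) (dirDeriv_dirT_polar hI ha hF) _ hq,
        dirDeriv_dirT_polar hI ha (hF.dirDeriv hO _) hq] at h1
      simp only [polar] at h1 ⊢
      rw [h2, h3] at h1
      simpa using h1
  intro p hp
  have hx : 0 < ‖p.2.2‖ := norm_pos_iff.2 hp.2.2
  rw [h.dirDeriv_profX hI hF i p hp ‖p.2.2‖⁻¹ (by positivity)]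
  have hd (x : R3) (hx : x ≠ 0) : (p.1, p.2.1, x) ∈ profileDomain I a b := ⟨hp.1, hp.2.1, hx⟩
  have hpd (i : Fin 3) : EqOn (pd i fun y => F (p.1, p.2.1, y))
      (fun y => dirDeriv (profX i) F (p.1, p.2.1, y)) {x | x ≠ 0} := fun x hx =>
    pd_slice (hF.diffAt hO (hd x hx)) i
  have key := pd_eq_zero_of_harmonic_of_homogeneous (h := fun y => F (p.1, p.2.1, y))
    (contDiffOn_slice hF hp.1 hp.2.1)
    (fun x hx l hl => by simpa using (h _ (hd x hx) l hl).symm)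
    (fun x hx => by
      rw [← hlap _ (hd x hx)]
      refine Finset.sum_congr rfl fun i _ => ?_
      refine (dirDeriv_congr isOpen_punctured (hpd i) _ hx).trans ?_
      exact pd_slice ((hF.dirDeriv hO _).diffAt hO (hd x hx)) i)
    (‖p.2.2‖⁻¹ • p.2.2) (by rw [norm_smul, norm_inv, norm_norm, inv_mul_cancel₀ hx.ne']) i
  rw [hpd i (smul_ne_zero (inv_ne_zero hx.ne') hp.2.2)] at key
  exact (congrArg _ key).trans (smul_zero _)

/-- The radial wave equation is inherited by the time derivative. -/
lemma radial_wave_profT (hI : IsOpen I) (ha : 0 < a) {F : ℝ × ℝ × R3 → E}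
    (hF : ContDiffOn ℝ ∞ F (profileDomain I a b))
    (hrad : ∀ p ∈ profileDomain I a b, dirDeriv profT (dirDeriv profT F) p
      = dirDeriv profR (dirDeriv profR F) p + (2 / p.2.1) • dirDeriv profR F p) :
    ∀ p ∈ profileDomain I a b, dirDeriv profT (dirDeriv profT (dirDeriv profT F)) p
      = dirDeriv profR (dirDeriv profR (dirDeriv profT F)) p
        + (2 / p.2.1) • dirDeriv profR (dirDeriv profT F) p := by
  have hO := isOpen_profileDomain (a := a) (b := b) hI
  intro p hp
  have hR := hF.dirDeriv hO profR
  have hr := ne_zero_of_mem_profileDomain ha hp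
  have hc : HasFDerivAt (fun p : ℝ × ℝ × R3 => p.2.1)
      ((ContinuousLinearMap.fst ℝ ℝ R3).comp (ContinuousLinearMap.snd ℝ ℝ (ℝ × R3))) p :=
    hasFDerivAt_fst.comp p hasFDerivAt_snd
  have hinv : DifferentiableAt ℝ (fun r : ℝ => 2 / r) p.2.1 := by fun_prop (disch := exact hr)
  have hcd : DifferentiableAt ℝ (fun p : ℝ × ℝ × R3 => 2 / p.2.1) p :=
    hinv.comp p hc.differentiableAt
  have hc0 : fderiv ℝ (fun p : ℝ × ℝ × R3 => 2 / p.2.1) p profT = 0 := by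
    refine (dirDeriv_comp hc hinv profT).trans ?_
    simp [dirDeriv, profT]
  rw [dirDeriv_congr hO (g := fun p => (2 / p.2.1) • dirDeriv profR F p
      + dirDeriv profR (dirDeriv profR F) p) (fun p hp => (hrad p hp).trans (add_comm _ _)) _ hp,
    dirDeriv_add_smul hcd (hR.diffAt hO hp)
      ((hR.dirDeriv hO _).diffAt hO hp), hc0, zero_smul, add_zero,
    dirDeriv_comm hO hF profT profR hp, dirDeriv_comm hO hR profT profR hp,
    dirDeriv_congr hO (dirDeriv_comm hO hF profT profR) _ hp, add_comm]

end Polar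

section Maxwell

variable {X : Type*} [NormedAddCommGroup X] [NormedSpace ℝ X] {s : Set X}

lemma dirDeriv_of_eq_mul_sub (hs : IsOpen s) {P Q R : X → ℂ} {σ : ℂ}
    (h : ∀ x ∈ s, P x = σ * (Q x - R x)) (hQ : ContDiffOn ℝ ∞ Q s) (hR : ContDiffOn ℝ ∞ R s)
    (v : X) : ∀ x ∈ s, dirDeriv v P x = σ * (dirDeriv v Q x - dirDeriv v R x) := fun x hx => by
  have hQx := hQ.diffAt hs hx
  have hRx := hR.diffAt hs hx
  rw [dirDeriv_congr hs (g := fun x => σ * (Q x - R x)) h v hx]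
  unfold dirDeriv
  rw [fderiv_const_mul (hQx.fun_sub hRx), fderiv_fun_sub hQx hRx]
  simp

/-- One half of the dynamic Maxwell equations: `∂_T E = σ curl B` on `s`, where `ξ` are the
spatial directions. -/
def CurlEq (s : Set X) (T : X) (ξ : Fin 3 → X) (σ : ℂ) (E B : Fin 3 → X → ℂ) : Prop :=
  ∀ i, ∀ x ∈ s, dirDeriv T (E i) x
    = σ * (dirDeriv (ξ (i + 1)) (B (i + 2)) x - dirDeriv (ξ (i + 2)) (B (i + 1)) x)

variable {T : X} {ξ : Fin 3 → X} {σ : ℂ} {E B : Fin 3 → X → ℂ}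

lemma CurlEq.time_deriv (hs : IsOpen s) (hB : ∀ i, ContDiffOn ℝ ∞ (B i) s)
    (h : CurlEq s T ξ σ E B) :
    CurlEq s T ξ σ (fun i => dirDeriv T (E i)) (fun i => dirDeriv T (B i)) := fun i x hx => by
  rw [dirDeriv_of_eq_mul_sub hs (h i) ((hB _).dirDeriv hs _) ((hB _).dirDeriv hs _) T x hx,
    dirDeriv_comm hs (hB _) T _ hx, dirDeriv_comm hs (hB _) T _ hx]

lemma fin3_sum_cyclic (f : Fin 3 → ℂ) (i : Fin 3) : ∑ k, f k = f i + f (i + 1) + f (i + 2) := by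
  fin_cases i <;> simp [Fin.sum_univ_three] <;> ring

lemma CurlEq.div_time_deriv (hs : IsOpen s) (hB : ∀ i, ContDiffOn ℝ ∞ (B i) s)
    (h : CurlEq s T ξ σ E B) : ∀ x ∈ s, ∑ i, dirDeriv (ξ i) (dirDeriv T (E i)) x = 0 := by
  intro x hx
  have key (i : Fin 3) := dirDeriv_of_eq_mul_sub hs (h i) ((hB _).dirDeriv hs _)
    ((hB _).dirDeriv hs _) (ξ i) x hx
  have h0 := dirDeriv_comm hs (hB 0) (ξ 1) (ξ 2) hx
  have h1 := dirDeriv_comm hs (hB 1) (ξ 0) (ξ 2) hx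
  have h2 := dirDeriv_comm hs (hB 2) (ξ 0) (ξ 1) hx
  simp only [key, Fin.sum_univ_three]
  simp only [show (0 : Fin 3) + 1 = 1 from rfl, show (0 : Fin 3) + 2 = 2 from rfl,
    show (1 : Fin 3) + 1 = 2 from rfl, show (1 : Fin 3) + 2 = 0 from rfl,
    show (2 : Fin 3) + 1 = 0 from rfl, show (2 : Fin 3) + 2 = 1 from rfl]
  rw [h0, h1, h2]
  ring

lemma CurlEq.wave_time_deriv (hs : IsOpen s) (hσ : σ * σ = 1)
    (hE : ∀ i, ContDiffOn ℝ ∞ (E i) s) (hB : ∀ i, ContDiffOn ℝ ∞ (B i) s)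
    (h : CurlEq s T ξ σ E B) (h' : CurlEq s T ξ (-σ) B E) (i : Fin 3) :
    ∀ x ∈ s, dirDeriv T (dirDeriv T (dirDeriv T (E i))) x
      = ∑ k, dirDeriv (ξ k) (dirDeriv (ξ k) (dirDeriv T (E i))) x := by
  intro x hx
  have hA (i) : ContDiffOn ℝ ∞ (dirDeriv T (E i)) s := (hE i).dirDeriv hs T
  have hC (i) : ContDiffOn ℝ ∞ (dirDeriv T (B i)) s := (hB i).dirDeriv hs T
  have h1 := (h.time_deriv hs hB).time_deriv hs hC i x hx
  have h2 (j k : Fin 3) := dirDeriv_of_eq_mul_sub hs (h'.time_deriv hs hE j)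
    ((hA _).dirDeriv hs _) ((hA _).dirDeriv hs _) (ξ k) x hx
  have hdiv : ∑ k, dirDeriv (ξ i) (dirDeriv (ξ k) (dirDeriv T (E k))) x = 0 := by
    have h3 := dirDeriv_eq_zero_of_eqOn hs (h.div_time_deriv hs hB) (ξ i) x hx
    have hd (k) := ((hA k).dirDeriv hs (ξ k)).diffAt hs hx
    unfold dirDeriv at h3 hd ⊢
    rw [fderiv_fun_sum fun k _ => hd k] at h3
    simpa using h3
  have c1 := dirDeriv_comm hs (hA (i + 1)) (ξ i) (ξ (i + 1)) hx
  have c2 := dirDeriv_comm hs (hA (i + 2)) (ξ i) (ξ (i + 2)) hx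
  have i1 : i + 1 + 1 = i + 2 := by fin_cases i <;> rfl
  have i2 : i + 1 + 2 = i := by fin_cases i <;> rfl
  have i3 : i + 2 + 1 = i := by fin_cases i <;> rfl
  have i4 : i + 2 + 2 = i + 1 := by fin_cases i <;> rfl
  rw [fin3_sum_cyclic _ i] at hdiv ⊢
  rw [h2, h2, i1, i2, i3, i4] at h1
  rw [h1]
  rw [c1, c2] at hdiv
  linear_combination (dirDeriv (ξ (i + 1)) (dirDeriv (ξ (i + 1)) (dirDeriv T (E i))) x
    + dirDeriv (ξ (i + 2)) (dirDeriv (ξ (i + 2)) (dirDeriv T (E i))) x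
    - dirDeriv (ξ (i + 1)) (dirDeriv (ξ i) (dirDeriv T (E (i + 1)))) x
    - dirDeriv (ξ (i + 2)) (dirDeriv (ξ i) (dirDeriv T (E (i + 2)))) x) * hσ - hdiv

end Maxwell

section Profile

variable {I : Set ℝ} {a b : ℝ}

/-- The hypotheses on a scalar component of a modulated spherical profile. -/
structure IsSphericalProfile (I : Set ℝ) (a b : ℝ) (F : ℝ × ℝ × R3 → ℂ) : Prop where
  smooth : ContDiffOn ℝ ∞ F (profileDomain I a b)
  hom : HomNeg I a b 0 F
  radial : ∀ p ∈ profileDomain I a b, dirDeriv profT (dirDeriv profT F) p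
    = dirDeriv profR (dirDeriv profR F) p + (2 / p.2.1) • dirDeriv profR F p

variable {σ : ℂ} {E B : Fin 3 → ℝ × ℝ × R3 → ℂ}

/-- The time derivative of the field does not depend on the angular variable. -/
lemma dirDeriv_profX_profT_eq_zero (hI : IsOpen I) (ha : 0 < a) (hσ : σ * σ = 1)
    (hE : ∀ i, IsSphericalProfile I a b (E i)) (hB : ∀ i, IsSphericalProfile I a b (B i))
    (h : CurlEq (shell I a b) dirT dirX σ (fun i q => E i (polar q)) (fun i q => B i (polar q)))
    (h' : CurlEq (shell I a b) dirT dirX (-σ) (fun i q => B i (polar q))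
      (fun i q => E i (polar q))) (i k : Fin 3) :
    ∀ p ∈ profileDomain I a b, dirDeriv (profX k) (dirDeriv profT (E i)) p = 0 := by
  have hO := isOpen_profileDomain (a := a) (b := b) hI
  have hS := isOpen_shell (a := a) (b := b) hI
  refine HomNeg.dirDeriv_profX_eq_zero hI ha ((hE i).smooth.dirDeriv hO _)
    ((hE i).hom.dirDeriv_profT hI (hE i).smooth)
    (radial_wave_profT hI ha (hE i).smooth (hE i).radial) (fun q hq => ?_) k
  have hT := dirDeriv_dirT_polar hI ha (hE i).smooth
  rw [← dirDeriv_congr hS (dirDeriv_congr hS hT dirT) dirT hq,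
    h.wave_time_deriv hS hσ (fun i => contDiffOn_comp_polar ha (hE i).smooth)
      (fun i => contDiffOn_comp_polar ha (hB i).smooth) h' i q hq]
  exact Finset.sum_congr rfl fun k _ => dirDeriv_congr hS (dirDeriv_congr hS hT _) _ hq

/-- The time derivative of the field does not depend on the radial variable. -/
lemma dirDeriv_profR_profT_eq_zero (hI : IsOpen I) (ha : 0 < a)
    (hE : ∀ i, IsSphericalProfile I a b (E i)) (hB : ∀ i, IsSphericalProfile I a b (B i))
    (h : CurlEq (shell I a b) dirT dirX σ (fun i q => E i (polar q)) (fun i q => B i (polar q)))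
    (hX : ∀ i k, ∀ p ∈ profileDomain I a b, dirDeriv (profX k) (dirDeriv profT (E i)) p = 0)
    (k : Fin 3) :
    ∀ p ∈ profileDomain I a b, dirDeriv profR (dirDeriv profT (E k)) p = 0 := by
  have hO := isOpen_profileDomain (a := a) (b := b) hI
  have hS := isOpen_shell (a := a) (b := b) hI
  have hA (i) : ContDiffOn ℝ ∞ (dirDeriv profT (E i)) (profileDomain I a b) :=
    (hE i).smooth.dirDeriv hO _
  have hRs (i) : ContDiffOn ℝ ∞ (dirDeriv profR (dirDeriv profT (E i))) (profileDomain I a b) :=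
    (hA i).dirDeriv hO _
  have hXR (i k) : ∀ p ∈ profileDomain I a b,
      dirDeriv (profX k) (dirDeriv profR (dirDeriv profT (E i))) p = 0 := fun p hp => by
    rw [dirDeriv_comm hO (hA i) _ _ hp, dirDeriv_eq_zero_of_eqOn hO (hX i k) _ p hp]
  have hsum : ∀ p ∈ profileDomain I a b,
      ∑ i, radialSlope i p • dirDeriv profR (dirDeriv profT (E i)) p = 0 := by
    have hdiv : ∀ q ∈ shell I a b,
        ∑ i, radialSlope i (polar q) • dirDeriv profR (dirDeriv profT (E i)) (polar q) = 0 := by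
      intro q hq
      rw [← h.div_time_deriv hS (fun i => contDiffOn_comp_polar ha (hB i).smooth) q hq]
      refine Finset.sum_congr rfl fun i _ => ?_
      rw [dirDeriv_congr hS (dirDeriv_dirT_polar hI ha (hE i).smooth) _ hq,
        dirDeriv_dirX_polar hI ha (hA i) i hq]
      beta_reduce
      rw [hX i i _ (polar_mem ha hq), add_zero]
      rfl
    intro p hp
    have hr := ne_zero_of_mem_profileDomain ha hp
    have hx : ‖p.2.2‖ ≠ 0 := norm_ne_zero_iff.2 hp.2.2
    have hhom : HomNeg I a b 0 fun p' : ℝ × ℝ × R3 =>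
        ∑ i, (‖p'.2.2‖⁻¹ * p'.2.2 i) • dirDeriv profR (dirDeriv profT (E i)) p' := by
      intro p hp l hl
      have hx : ‖p.2.2‖ ≠ 0 := norm_ne_zero_iff.2 hp.2.2
      rw [pow_zero, one_smul]
      refine Finset.sum_congr rfl fun i _ => ?_
      rw [((hE i).hom.dirDeriv_profT hI (hE i).smooth).dirDeriv_profR hI (hA i) p hp l hl,
        norm_smul, Real.norm_of_nonneg hl.le]
      simp only [pow_zero, one_smul, PiLp.smul_apply, smul_eq_mul]
      congr 1
      field_simp
    have h0 := hhom.eq_zero_of_polar ha (fun q hq => hdiv q hq) p hp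
    have h1 := congrArg (fun z => (p.2.1⁻¹ * ‖p.2.2‖) • z) h0
    simp only [smul_zero, Finset.smul_sum, smul_smul] at h1
    rw [← h1]
    refine Finset.sum_congr rfl fun i _ => ?_
    congr 1
    simp only [radialSlope]
    field_simp
  intro p hp
  have hr := ne_zero_of_mem_profileDomain ha hp
  have hd := dirDeriv_eq_zero_of_eqOn hO hsum (profX k) p hp
  have hsl (i) : DifferentiableAt ℝ (radialSlope i) p :=
    (contDiffAt_radialSlope i hr).differentiableAt (by simp)
  have hterm (i : Fin 3) : fderiv ℝ (fun p =>
      radialSlope i p • dirDeriv profR (dirDeriv profT (E i)) p) p (profX k)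
      = if i = k then p.2.1⁻¹ • dirDeriv profR (dirDeriv profT (E i)) p else 0 := by
    have h0 := hXR i k p hp
    rw [dirDeriv] at h0
    rw [fderiv_fun_smul (hsl i) ((hRs i).diffAt hO hp)]
    simp only [_root_.add_apply, _root_.smul_apply, h0, smul_zero, zero_add,
      ContinuousLinearMap.smulRight_apply, fderiv_radialSlope i hr]
    split_ifs with hik <;> simp [profX, hik]
  rw [dirDeriv, fderiv_fun_sum fun i _ => (hsl i).fun_smul ((hRs i).diffAt hO hp)] at hd
  simp only [_root_.sum_apply, hterm, Finset.sum_ite_eq', Finset.mem_univ, if_true] at hd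
  exact (smul_eq_zero.1 hd).resolve_left (inv_ne_zero hr)

lemma fderiv_eq_zero_of_dirDeriv {F : ℝ × ℝ × R3 → ℂ} {p : ℝ × ℝ × R3}
    (hT : dirDeriv profT F p = 0) (hR : dirDeriv profR F p = 0)
    (hX : ∀ k, dirDeriv (profX k) F p = 0) : fderiv ℝ F p = 0 := by
  refine ContinuousLinearMap.ext fun v => ?_
  have hv : v = v.1 • profT + v.2.1 • profR + ∑ k, v.2.2 k • profX k := by
    have h1 : ∑ k, v.2.2 k • profX k = ContinuousLinearMap.inr ℝ ℝ (ℝ × R3)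
        (ContinuousLinearMap.inr ℝ ℝ R3 v.2.2) := by
      conv_rhs => rw [← sum_smul_single v.2.2]
      simp only [map_sum, map_smul]
      rfl
    rw [h1]
    simp [profT, profR]
  simp only [dirDeriv] at hT hR hX
  rw [hv]
  simp only [map_add, map_smul, map_sum, hT, hR, hX]
  simp

/-- The time derivative of the field is constant. -/
lemma exists_dirDeriv_profT_eq_const (hI : IsOpen I) (hIc : I.OrdConnected) (ha : 0 < a)
    (hσ : σ * σ = 1)
    (hE : ∀ i, IsSphericalProfile I a b (E i)) (hB : ∀ i, IsSphericalProfile I a b (B i))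
    (h : CurlEq (shell I a b) dirT dirX σ (fun i q => E i (polar q)) (fun i q => B i (polar q)))
    (h' : CurlEq (shell I a b) dirT dirX (-σ) (fun i q => B i (polar q))
      (fun i q => E i (polar q))) (i : Fin 3) :
    ∃ c, ∀ p ∈ profileDomain I a b, dirDeriv profT (E i) p = c := by
  have hO := isOpen_profileDomain (a := a) (b := b) hI
  have hS := isOpen_shell (a := a) (b := b) hI
  have hXE := dirDeriv_profX_profT_eq_zero hI ha hσ hE hB h h'
  have hXB := dirDeriv_profX_profT_eq_zero hI ha (σ := -σ) (by simpa using hσ) hB hE h'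
    (by simpa using h)
  have hRE := dirDeriv_profR_profT_eq_zero hI ha hE hB h hXE
  have hRB := dirDeriv_profR_profT_eq_zero hI ha hB hE h' hXB
  have hT : ∀ p ∈ profileDomain I a b, dirDeriv profT (dirDeriv profT (E i)) p = 0 := by
    refine HomNeg.eq_zero_of_polar ha (((hE i).hom.dirDeriv_profT hI
      (hE i).smooth).dirDeriv_profT hI ((hE i).smooth.dirDeriv hO _)) fun q hq => ?_
    have hp := polar_mem ha hq
    have hB0 (j k : Fin 3) :
        dirDeriv (dirX k) (dirDeriv dirT fun q => B j (polar q)) q = 0 := by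
      rw [dirDeriv_congr hS (dirDeriv_dirT_polar hI ha (hB j).smooth) _ hq,
        dirDeriv_dirX_polar hI ha ((hB j).smooth.dirDeriv hO _) k hq]
      beta_reduce
      rw [hXB j k _ hp, hRB j _ hp]
      simp
    refine (dirDeriv_dirT_polar hI ha ((hE i).smooth.dirDeriv hO _) hq).symm.trans ?_
    rw [← dirDeriv_congr hS (dirDeriv_dirT_polar hI ha (hE i).smooth) _ hq,
      h.time_deriv hS (fun i => contDiffOn_comp_polar ha (hB i).smooth) i q hq, hB0, hB0]
    simp
  have hconn : IsPreconnected (profileDomain I a b) :=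
    hIc.isPreconnected.prod (isPreconnected_Ioo.prod
      (isConnected_compl_singleton_of_one_lt_rank (by
        rw [← Module.finrank_eq_rank]; simp) (0 : R3)).isPreconnected)
  exact hO.exists_is_const_of_fderiv_eq_zero hconn
    (((hE i).smooth.dirDeriv hO _).differentiableOn (by simp)) fun p hp =>
    fderiv_eq_zero_of_dirDeriv (hT p hp) (hRE i p hp) fun k => hXE i k p hp

end Profile

section Slices

variable {I : Set ℝ} {a b : ℝ} {H : Type*} [NormedAddCommGroup H] [NormedSpace ℝ H]

lemma deriv_time_slice {U : ℝ × R3 → H} {t : ℝ} {x : R3} (hU : DifferentiableAt ℝ U (t, x)) :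
    deriv (fun s => U (s, x)) t = dirDeriv dirT U (t, x) := by
  rw [← fderiv_apply_one_eq_deriv]
  exact dirDeriv_comp (hasFDerivAt_prodMk_left t x) hU 1

lemma pd_space_slice {U : ℝ × R3 → H} {t : ℝ} {x : R3} (hU : DifferentiableAt ℝ U (t, x))
    (i : Fin 3) : pd i (fun y => U (t, y)) x = dirDeriv (dirX i) U (t, x) :=
  dirDeriv_comp (hasFDerivAt_prodMk_right t x) hU _

lemma waveOp_eq {s : Set (ℝ × R3)} (hs : IsOpen s) {U : ℝ × R3 → ℂ} (hU : ContDiffOn ℝ ∞ U s)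
    {t : ℝ} {x : R3} (hq : (t, x) ∈ s) : waveOp (fun s y => U (s, y)) t x
      = dirDeriv dirT (dirDeriv dirT U) (t, x)
        - ∑ i, dirDeriv (dirX i) (dirDeriv (dirX i) U) (t, x) := by
  have hT : (fun s => deriv (fun s' => U (s', x)) s) =ᶠ[𝓝 t]
      fun s => dirDeriv dirT U (s, x) := by
    have : ∀ᶠ r in 𝓝 t, (r, x) ∈ s :=
      (Continuous.prodMk_left x).continuousAt.eventually_mem (hs.mem_nhds hq)
    filter_upwards [this] with r hr using deriv_time_slice (hU.diffAt hs hr)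
  have hX (i : Fin 3) : (fun y => pd i (fun z => U (t, z)) y) =ᶠ[𝓝 x]
      fun y => dirDeriv (dirX i) U (t, y) := by
    have : ∀ᶠ y in 𝓝 x, (t, y) ∈ s :=
      (Continuous.prodMk_right t).continuousAt.eventually_mem (hs.mem_nhds hq)
    filter_upwards [this] with y hy using pd_space_slice (hU.diffAt hs hy) i
  have hXX (i : Fin 3) : pd i (fun y => pd i (fun z => U (t, z)) y) x
      = dirDeriv (dirX i) (dirDeriv (dirX i) U) (t, x) := by
    rw [← pd_space_slice ((hU.dirDeriv hs _).diffAt hs hq)]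
    simp only [pd] at hX ⊢
    rw [(hX i).fderiv_eq]
  rw [waveOp, hT.deriv_eq, deriv_time_slice ((hU.dirDeriv hs _).diffAt hs hq), hXX, hXX, hXX,
    Fin.sum_univ_three]

/-- The wave equation for the radial functions `(t,x) ↦ F (t,|x|,ω)`, in profile coordinates. -/
lemma isSphericalProfile_of_waveOp (hI : IsOpen I) (ha : 0 < a) {F : ℝ × ℝ × R3 → ℂ}
    (hF : ContDiffOn ℝ ∞ F (profileDomain I a b)) (hhom : HomNeg I a b 0 F)
    (hw : ∀ e : R3, ‖e‖ = 1 → ∀ t ∈ I, ∀ x : R3, a < ‖x‖ → ‖x‖ < b →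
      waveOp (fun s y => F (s, ‖y‖, e)) t x = 0) : IsSphericalProfile I a b F := by
  refine ⟨hF, hhom, fun p hp => ?_⟩
  have hO := isOpen_profileDomain (a := a) (b := b) hI
  have hx : 0 < ‖p.2.2‖ := norm_pos_iff.2 hp.2.2
  have hr : 0 < p.2.1 := ha.trans hp.2.1.1
  obtain ⟨e, he⟩ : ∃ e, e = ‖p.2.2‖⁻¹ • p.2.2 := ⟨_, rfl⟩
  have hen : ‖e‖ = 1 := by rw [he, norm_smul, norm_inv, norm_norm, inv_mul_cancel₀ hx.ne']
  have he0 : e ≠ 0 := by rintro rfl; simp at hen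
  let L : ℝ × ℝ × R3 → ℝ × ℝ × R3 := fun p => (p.1, p.2.1, e)
  have hL (p) : HasFDerivAt L (((ContinuousLinearMap.fst ℝ ℝ (ℝ × R3))).prod
      (((ContinuousLinearMap.fst ℝ ℝ R3).comp (ContinuousLinearMap.snd ℝ ℝ (ℝ × R3))).prod 0)) p :=
    hasFDerivAt_fst.prodMk ((hasFDerivAt_fst.comp p hasFDerivAt_snd).prodMk
      (hasFDerivAt_const e p))
  have hLm {p} (hp : p ∈ profileDomain I a b) : L p ∈ profileDomain I a b :=
    ⟨hp.1, hp.2.1, he0⟩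
  have hLT {G : ℝ × ℝ × R3 → ℂ} (hG : ContDiffOn ℝ ∞ G (profileDomain I a b)) :
      EqOn (dirDeriv profT fun p => G (L p)) (fun p => dirDeriv profT G (L p))
        (profileDomain I a b) := fun p hp => by
    rw [dirDeriv_comp (hL p) (hG.diffAt hO (hLm hp))]
    simp [profT]
  have hLR {G : ℝ × ℝ × R3 → ℂ} (hG : ContDiffOn ℝ ∞ G (profileDomain I a b)) :
      EqOn (dirDeriv profR fun p => G (L p)) (fun p => dirDeriv profR G (L p))
        (profileDomain I a b) := fun p hp => by
    rw [dirDeriv_comp (hL p) (hG.diffAt hO (hLm hp))]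
    simp [profR]
  have hLX (k) : ∀ p ∈ profileDomain I a b,
      dirDeriv (profX k) (fun p => F (L p)) p = 0 := fun p hp => by
    rw [dirDeriv_comp (hL p) (hF.diffAt hO (hLm hp))]
    simp only [dirDeriv, profX]
    exact (fderiv ℝ F (L p)).map_zero
  have hFL : ContDiffOn ℝ ∞ (fun p => F (L p)) (profileDomain I a b) :=
    hF.comp (f := L) (by fun_prop) fun p hp => hLm hp
  have hn : ‖p.2.1 • e‖ = p.2.1 := by rw [norm_smul, hen, Real.norm_of_nonneg hr.le, mul_one]
  have hq : (p.1, p.2.1 • e) ∈ shell I a b :=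
    ⟨hp.1, by rw [mem_ofPred_eq, hn]; exact hp.2.1⟩
  have hpol : polar (p.1, p.2.1 • e) = (p.1, p.2.1, p.2.1 • e) := by simp only [polar, hn]
  have hpm := polar_mem ha hq
  have hw0 := hw e hen p.1 hp.1 (p.2.1 • e) hq.2.1 hq.2.2
  have h1 := waveOp_eq (isOpen_shell hI) (contDiffOn_comp_polar ha hFL) hq
  have hXR (k) : dirDeriv (profX k) (dirDeriv profR fun p => F (L p)) (polar (p.1, p.2.1 • e))
      = 0 := by
    rw [dirDeriv_comm hO hFL _ _ hpm, dirDeriv_eq_zero_of_eqOn hO (hLX k) _ _ hpm]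
  have hXX (k) : dirDeriv (profX k) (dirDeriv (profX k) fun p => F (L p))
      (polar (p.1, p.2.1 • e)) = 0 := dirDeriv_eq_zero_of_eqOn hO (hLX k) _ _ hpm
  have h2 : dirDeriv profT (dirDeriv profT F) (p.1, p.2.1, e)
      = dirDeriv profR (dirDeriv profR F) (p.1, p.2.1, e)
        + (2 / p.2.1) • dirDeriv profR F (p.1, p.2.1, e) := by
    have h3 := h1.symm.trans hw0
    rw [laplacian_polar hI ha hFL hq,
      dirDeriv_congr (isOpen_shell hI) (dirDeriv_dirT_polar hI ha hFL) _ hq,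
      dirDeriv_dirT_polar hI ha (hFL.dirDeriv hO _) hq] at h3
    beta_reduce at h3
    rw [dirDeriv_congr hO (hLT hF) _ hpm, hLT (hF.dirDeriv hO _) hpm,
      dirDeriv_congr hO (hLR hF) _ hpm, hLR (hF.dirDeriv hO _) hpm] at h3
    simp only [hXR, hXX, hLR hF hpm, smul_zero, Finset.sum_const_zero, add_zero, hn] at h3
    rw [hpol] at h3
    exact sub_eq_zero.1 h3
  have hom1 := (hhom.dirDeriv_profT hI hF).dirDeriv_profT hI (hF.dirDeriv hO _) p hp
    ‖p.2.2‖⁻¹ (by positivity)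
  have hom2 := (hhom.dirDeriv_profR hI hF).dirDeriv_profR hI (hF.dirDeriv hO _) p hp
    ‖p.2.2‖⁻¹ (by positivity)
  have hom3 := hhom.dirDeriv_profR hI hF p hp ‖p.2.2‖⁻¹ (by positivity)
  rw [hom1, hom2, hom3, ← he, h2]
  simp

end Slices


section Assembly

variable {I : Set ℝ} {a b : ℝ}

lemma HomNeg.apply_polar (ha : 0 < a) {F : ℝ × ℝ × R3 → ℂ} (h : HomNeg I a b 0 F) {t : ℝ} {x : R3}
    (hq : (t, x) ∈ shell I a b) : F (t, ‖x‖, ‖x‖⁻¹ • x) = F (polar (t, x)) := by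
  have hx : 0 < ‖x‖ := ha.trans hq.2.1
  simpa [polar] using (h _ (polar_mem ha hq) ‖x‖⁻¹ (by positivity)).symm

lemma curlEq_of_curl3C (hI : IsOpen I) (ha : 0 < a) {σ : ℂ} {E B : Fin 3 → ℝ × ℝ × R3 → ℂ}
    (hE : ∀ i, IsSphericalProfile I a b (E i)) (hB : ∀ i, IsSphericalProfile I a b (B i))
    (h : ∀ t ∈ I, ∀ x : R3, a < ‖x‖ → ‖x‖ < b → ∀ i,
      deriv (fun s => E i (s, ‖x‖, ‖x‖⁻¹ • x)) t
        = σ * curl3C (fun y i' => B i' (t, ‖y‖, ‖y‖⁻¹ • y)) x i) :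
    CurlEq (shell I a b) dirT dirX σ (fun i q => E i (polar q)) (fun i q => B i (polar q)) := by
  rintro i ⟨t, x⟩ hq
  have hS := isOpen_shell (a := a) (b := b) hI
  have hT : (fun s => E i (s, ‖x‖, ‖x‖⁻¹ • x)) =ᶠ[𝓝 t] fun s => E i (polar (s, x)) := by
    have : ∀ᶠ r in 𝓝 t, (r, x) ∈ shell I a b :=
      (Continuous.prodMk_left x).continuousAt.eventually_mem (hS.mem_nhds hq)
    filter_upwards [this] with r hr using (hE i).hom.apply_polar ha hr
  have hX (j k) : pd k (fun y => B j (t, ‖y‖, ‖y‖⁻¹ • y)) x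
      = dirDeriv (dirX k) (fun q => B j (polar q)) (t, x) := by
    have : ∀ᶠ y in 𝓝 x, (t, y) ∈ shell I a b :=
      (Continuous.prodMk_right t).continuousAt.eventually_mem (hS.mem_nhds hq)
    have h1 : (fun y => B j (t, ‖y‖, ‖y‖⁻¹ • y)) =ᶠ[𝓝 x] fun y => B j (polar (t, y)) := by
      filter_upwards [this] with y hy using (hB j).hom.apply_polar ha hy
    rw [← pd_space_slice ((contDiffOn_comp_polar ha (hB j).smooth).diffAt hS hq), pd, pd,
      h1.fderiv_eq]
  have h0 := h t hq.1 x hq.2.1 hq.2.2 i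
  rw [hT.deriv_eq,
    deriv_time_slice ((contDiffOn_comp_polar ha (hE i).smooth).diffAt hS hq)] at h0
  rw [h0]
  simp only [curl3C, hX]
  fin_cases i <;> rfl

lemma contDiffOn_component {w : ℝ → ℝ → R3 → Fin 6 → ℂ}
    (hsm : ∀ n : ℕ, ContDiffOn ℝ n (fun p : ℝ × ℝ × R3 => w p.1 p.2.1 p.2.2)
      (I ×ˢ (Ioo a b) ×ˢ {x : R3 | x ≠ 0})) (j : Fin 6) :
    ContDiffOn ℝ ∞ (fun p : ℝ × ℝ × R3 => w p.1 p.2.1 p.2.2 j) (profileDomain I a b) :=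
  contDiffOn_pi.1 (contDiffOn_infty.2 hsm) j

/-- A profile whose time derivative is constant is affine in time. -/
lemma eq_add_of_dirDeriv_profT_eq_const (hI : IsOpen I) (hIc : I.OrdConnected)
    {F : ℝ × ℝ × R3 → ℂ} (hF : ContDiffOn ℝ ∞ F (profileDomain I a b)) {c : ℂ}
    (hc : ∀ p ∈ profileDomain I a b, dirDeriv profT F p = c) {t₀ t : ℝ} (ht₀ : t₀ ∈ I)
    (ht : t ∈ I) {p : ℝ × R3} (hp : p ∈ Ioo a b ×ˢ {x : R3 | x ≠ 0}) :
    F (t, p) = F (t₀, p) - t₀ * c + t * c := by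
  have hd : ∀ s ∈ I, HasDerivAt (fun s : ℝ => F (s, p) - s * c) 0 s := fun s hs => by
    have h0 : HasFDerivAt (fun s => (s, p)) (ContinuousLinearMap.inl ℝ ℝ (ℝ × R3)) s :=
      hasFDerivAt_prodMk_left s p
    have h1 := (hF.diffAt (isOpen_profileDomain hI) (x := (s, p)) ⟨hs, hp⟩).hasFDerivAt.comp s h0
    have h2 := h1.hasDerivAt.sub ((Complex.ofRealCLM.hasDerivAt (x := s)).mul_const c)
    have h3 := hc (s, p) ⟨hs, hp⟩
    refine h2.congr_deriv ?_
    rw [dirDeriv, profT] at h3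
    simp [← h3, Prod.mk_zero_zero]
  have := hI.is_const_of_deriv_eq_zero hIc.isPreconnected
    (fun s hs => (hd s hs).differentiableAt.differentiableWithinAt) (fun s hs => (hd s hs).deriv)
    ht ht₀
  linear_combination this

end Assembly

end Auxiliary

/-- **Corollary (dynamic equations alone).**
If `w(t,r,ω)` is a smooth `ℂ⁶`-valued modulated spherical profile each of whose components,
for fixed `ω ∈ S²`, satisfies the wave equation as a function of `(t,x)`, and if
`u(t,x) := w(t,|x|,x/|x|) = (E,B)` satisfies the dynamic Maxwell equations
`∂ₜE = curl B`, `∂ₜB = −curl E` on `{t ∈ I, a < |x| < b}`, then `u = f(x) + c t`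
for a constant `c ∈ ℂ⁶` and a function `f` of `x` alone. -/
theorem dynamic_maxwell_modulated_spherical
    (I : Set ℝ) (hIopen : IsOpen I) (hIne : I.Nonempty) (hIconn : I.OrdConnected)
    (a b : ℝ) (ha : 0 < a) (hab : a < b)
    (w : ℝ → ℝ → R3 → Fin 6 → ℂ)
    (hsm : ∀ n : ℕ, ContDiffOn ℝ n (fun p : ℝ × ℝ × R3 => w p.1 p.2.1 p.2.2)
      (I ×ˢ (Set.Ioo a b) ×ˢ {x : R3 | x ≠ 0}))
    (hhom : ∀ t ∈ I, ∀ r ∈ Set.Ioo a b, ∀ x : R3, x ≠ 0 → ∀ l : ℝ, 0 < l →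
      w t r (l • x) = w t r x)
    (hwave : ∀ ω : R3, ‖ω‖ = 1 → ∀ j : Fin 6, ∀ t ∈ I, ∀ x : R3, a < ‖x‖ → ‖x‖ < b →
      waveOp (fun s y => w s ‖y‖ ω j) t x = 0)
    (hdynE : ∀ t ∈ I, ∀ x : R3, a < ‖x‖ → ‖x‖ < b → ∀ i : Fin 3,
      deriv (fun s => w s ‖x‖ (‖x‖⁻¹ • x) (Fin.castLE (by omega) i)) t =
        curl3C (fun y i' => w t ‖y‖ (‖y‖⁻¹ • y) (⟨i'.1 + 3, by omega⟩ : Fin 6)) x i)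
    (hdynB : ∀ t ∈ I, ∀ x : R3, a < ‖x‖ → ‖x‖ < b → ∀ i : Fin 3,
      deriv (fun s => w s ‖x‖ (‖x‖⁻¹ • x) (⟨i.1 + 3, by omega⟩ : Fin 6)) t =
        - curl3C (fun y i' => w t ‖y‖ (‖y‖⁻¹ • y) (Fin.castLE (by omega) i')) x i) :
    ∃ c : Fin 6 → ℂ, ∃ f : R3 → Fin 6 → ℂ, ∀ t ∈ I, ∀ x : R3, a < ‖x‖ → ‖x‖ < b →
      w t ‖x‖ (‖x‖⁻¹ • x) = f x + (t : ℂ) • c := by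
  have hP (j : Fin 6) :
      IsSphericalProfile I a b fun p : ℝ × ℝ × R3 => w p.1 p.2.1 p.2.2 j :=
    isSphericalProfile_of_waveOp hIopen ha (contDiffOn_component hsm j)
      (fun p hp l hl => by
        simpa using (congrFun (hhom p.1 hp.1 p.2.1 hp.2.1 p.2.2 hp.2.2 l hl) j).symm)
      fun e he => hwave e he j
  let E (i : Fin 3) (p : ℝ × ℝ × R3) : ℂ := w p.1 p.2.1 p.2.2 (Fin.castLE (by omega) i)
  let B (i : Fin 3) (p : ℝ × ℝ × R3) : ℂ := w p.1 p.2.1 p.2.2 ⟨i.1 + 3, by omega⟩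
  have hE (i) : IsSphericalProfile I a b (E i) := hP _
  have hB (i) : IsSphericalProfile I a b (B i) := hP _
  have hEB := curlEq_of_curl3C (σ := 1) hIopen ha hE hB fun t ht x hxa hxb i =>
    (hdynE t ht x hxa hxb i).trans (one_mul _).symm
  have hBE := curlEq_of_curl3C (σ := -1) hIopen ha hB hE fun t ht x hxa hxb i =>
    (hdynB t ht x hxa hxb i).trans (neg_one_mul _).symm
  have hc (j : Fin 6) : ∃ c, ∀ p ∈ profileDomain I a b,
      dirDeriv profT (fun p : ℝ × ℝ × R3 => w p.1 p.2.1 p.2.2 j) p = c := by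
    by_cases hj : j.1 < 3
    · exact exists_dirDeriv_profT_eq_const hIopen hIconn ha (by simp) hE hB hEB hBE ⟨j, hj⟩
    · have h := exists_dirDeriv_profT_eq_const hIopen hIconn ha (by simp) hB hE hBE
        (by simpa using hEB) ⟨j - 3, by omega⟩
      simpa only [B, Nat.sub_add_cancel (not_lt.1 hj)] using h
  choose c hc using hc
  obtain ⟨t₀, ht₀⟩ := hIne
  refine ⟨c, fun x j => w t₀ ‖x‖ (‖x‖⁻¹ • x) j - t₀ * c j, fun t ht x hxa hxb => funext fun j => ?_⟩
  have hx : x ≠ 0 := norm_pos_iff.1 (ha.trans hxa)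
  exact eq_add_of_dirDeriv_profT_eq_const hIopen hIconn (hP j).smooth (hc j) ht₀ ht
    (p := (‖x‖, ‖x‖⁻¹ • x)) ⟨⟨hxa, hxb⟩, smul_ne_zero (inv_ne_zero (norm_ne_zero_iff.2 hx)) hx⟩
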